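/- Let X, X̃, U₁, U₂ be Banach spaces, let T be a C₀-semigroup on X with extrapolation setting (X₋₁, ι, T₋₁), let p, q ∈ [1,∞), suppose B₁ ∈ L(X̃, X₋₁) is L^p-admissible for T, B₂ ∈ L(U₂, X₋₁) is L^q-admissible for T, and F satisfies the standing assumptions. Fix t₀ ≥ 0, x₀ ∈ X, u₁ ∈ L^p(0,∞;U₁), u₂ ∈ L^q(0,∞;U₂), and let t_max ∈ (t₀,∞] be the supremum of all t₁ > t₀ for which Σ(A,[B₁,B₂],F) has a unique mild solution on [t₀,t₁] with these data, and let x : [t₀, t_max) → X be the function whose restriction to each such interval [t₀,t₁] is this mild solution. If t_max < ∞, then ‖x(t)‖ → ∞ as t → t_max from below. -/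

import Mathlib

open MeasureTheory Set Filter

/-- A `C₀`-semigroup on a Banach space `X`. -/
structure C0Semigroup (X : Type*) [NormedAddCommGroup X] [NormedSpace ℝ X] where
  toFun : ℝ → X →L[ℝ] X
  map_zero' : toFun 0 = ContinuousLinearMap.id ℝ X
  map_add' : ∀ s t : ℝ, 0 ≤ s → 0 ≤ t → toFun (s + t) = (toFun s).comp (toFun t)
  continuousOn_apply' : ∀ x : X, ContinuousOn (fun t => toFun t x) (Set.Ici 0)

instance {X : Type*} [NormedAddCommGroup X] [NormedSpace ℝ X] :
    CoeFun (C0Semigroup X) (fun _ => ℝ → X →L[ℝ] X) := ⟨C0Semigroup.toFun⟩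

/-- An extrapolation setting `(X₋₁, ι, T₋₁)` for a `C₀`-semigroup `T` on `X`. -/
structure Extrapolation {X : Type*} [NormedAddCommGroup X] [NormedSpace ℝ X]
    (Xm : Type*) [NormedAddCommGroup Xm] [NormedSpace ℝ Xm]
    (T : C0Semigroup X) where
  ι : X →L[ℝ] Xm
  ι_injective : Function.Injective ι
  ι_denseRange : DenseRange ι
  Tm : C0Semigroup Xm
  compat : ∀ t : ℝ, 0 ≤ t → ∀ x : X, Tm t (ι x) = ι (T t x)

/-- `L^p`-admissibility (for `p ∈ [1,∞)`) of `B : U → X₋₁` with respect to a family `S`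
of operators on `X₋₁` (typically the extrapolated, possibly rescaled, semigroup),
with admissibility constants `C t`. -/
def IsLpAdmissibleFor {X Xm U : Type*} [NormedAddCommGroup X] [NormedSpace ℝ X]
    [NormedAddCommGroup Xm] [NormedSpace ℝ Xm] [NormedAddCommGroup U] [NormedSpace ℝ U]
    (S : ℝ → Xm →L[ℝ] Xm) (ι : X →L[ℝ] Xm) (p : ℝ) (B : U →L[ℝ] Xm) (C : ℝ → ℝ) : Prop :=
  ∀ t : ℝ, 0 < t → ∀ u : ℝ → U,
    AEStronglyMeasurable u (volume.restrict (Set.Ioo 0 t)) →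
    IntegrableOn (fun s => ‖u s‖ ^ p) (Set.Ioo 0 t) →
    IntegrableOn (fun s => S (t - s) (B (u s))) (Set.Ioo 0 t) ∧
    ∃ y : X, ι y = (∫ s in Set.Ioo 0 t, S (t - s) (B (u s))) ∧
      ‖y‖ ≤ C t * (∫ s in Set.Ioo 0 t, ‖u s‖ ^ p) ^ (1 / p)

/-- The standing assumptions on the bilinearity `F : X × U₁ → X̃` with bound `m`. -/
structure StandingAssumptions {X U₁ Xt : Type*} [NormedAddCommGroup X] [NormedSpace ℝ X]
    [NormedAddCommGroup U₁] [NormedSpace ℝ U₁] [NormedAddCommGroup Xt] [NormedSpace ℝ Xt]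
    (m : ℝ) (F : X → U₁ → Xt) : Prop where
  norm_bound : ∀ x u, ‖F x u‖ ≤ m * ‖x‖ * ‖u‖
  lipschitz : ∀ Xb : Set X, Bornology.IsBounded Xb →
    ∃ L > 0, ∀ x ∈ Xb, ∀ y ∈ Xb, ∀ u, ‖F x u - F y u‖ ≤ L * ‖u‖ * ‖x - y‖
  stronglyMeasurable_comp : ∀ (f : ℝ → X) (g : ℝ → U₁),
    StronglyMeasurable f → StronglyMeasurable g →
    StronglyMeasurable (fun s => F (f s) (g s))

/-- A mild solution of `Σ(A,[B₁,B₂],F)` on `[t₀,t₁]` with initial value `x₀`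
and inputs `u₁, u₂`. -/
def IsMildSolutionOn {X Xt U₁ U₂ Xm : Type*}
    [NormedAddCommGroup X] [NormedSpace ℝ X]
    [NormedAddCommGroup Xt] [NormedSpace ℝ Xt]
    [NormedAddCommGroup U₁] [NormedSpace ℝ U₁]
    [NormedAddCommGroup U₂] [NormedSpace ℝ U₂]
    [NormedAddCommGroup Xm] [NormedSpace ℝ Xm]
    (T : C0Semigroup X) (E : Extrapolation Xm T)
    (B₁ : Xt →L[ℝ] Xm) (B₂ : U₂ →L[ℝ] Xm) (F : X → U₁ → Xt)
    (x₀ : X) (u₁ : ℝ → U₁) (u₂ : ℝ → U₂) (t₀ t₁ : ℝ) (x : ℝ → X) : Prop :=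
  ContinuousOn x (Set.Icc t₀ t₁) ∧
  ∀ t ∈ Set.Icc t₀ t₁,
    IntegrableOn (fun s => E.Tm (t - s) (B₁ (F (x s) (u₁ s)) + B₂ (u₂ s))) (Set.Ioo t₀ t) ∧
    E.ι (x t) = E.ι (T (t - t₀) x₀) +
      ∫ s in Set.Ioo t₀ t, E.Tm (t - s) (B₁ (F (x s) (u₁ s)) + B₂ (u₂ s))

/-- A global mild solution of `Σ(A,[B₁,B₂],F)`. -/
def IsGlobalMildSolution {X Xt U₁ U₂ Xm : Type*}
    [NormedAddCommGroup X] [NormedSpace ℝ X]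
    [NormedAddCommGroup Xt] [NormedSpace ℝ Xt]
    [NormedAddCommGroup U₁] [NormedSpace ℝ U₁]
    [NormedAddCommGroup U₂] [NormedSpace ℝ U₂]
    [NormedAddCommGroup Xm] [NormedSpace ℝ Xm]
    (T : C0Semigroup X) (E : Extrapolation Xm T)
    (B₁ : Xt →L[ℝ] Xm) (B₂ : U₂ →L[ℝ] Xm) (F : X → U₁ → Xt)
    (x₀ : X) (u₁ : ℝ → U₁) (u₂ : ℝ → U₂) (x : ℝ → X) : Prop :=
  ContinuousOn x (Set.Ici 0) ∧
  ∀ t₁ : ℝ, 0 < t₁ → IsMildSolutionOn T E B₁ B₂ F x₀ u₁ u₂ 0 t₁ x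

section Helpers

open scoped Topology ENNReal

/-- Translation is continuous in `L^p(ℝ)` for `1 ≤ p < ∞`. -/
theorem tendsto_eLpNorm_translate_sub {V : Type*} [NormedAddCommGroup V] {P : ℝ≥0∞}
    (hP : 1 ≤ P) (hP' : P ≠ ∞) {g : ℝ → V} (hg : MemLp g P volume) :
    Tendsto (fun h : ℝ => (eLpNorm (fun s => g (h + s) - g s) P volume).toReal) (𝓝 0) (𝓝 0) := by
  have : Fact (1 ≤ P) := ⟨hP⟩
  have : Fact (P ≠ ∞) := ⟨hP'⟩
  have hmp (h : ℝ) : MemLp (fun s => g (h + s)) P volume :=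
    hg.comp_measurePreserving (measurePreserving_add_left volume h)
  have key : Continuous fun h : ℝ => ‖(DomAddAct.mk h +ᵥ hg.toLp g) - hg.toLp g‖ := by
    have : Continuous fun h : ℝ => (DomAddAct.mk h +ᵥ hg.toLp g : Lp V P (volume : Measure ℝ)) :=
      continuous_vadd.comp (Continuous.prodMk DomAddAct.continuous_mk continuous_const)
    exact (this.sub continuous_const).norm
  have h0 := key.tendsto 0
  have heq (h : ℝ) : ‖(DomAddAct.mk h +ᵥ hg.toLp g) - hg.toLp g‖ =
      (eLpNorm (fun s => g (h + s) - g s) P volume).toReal := by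
    rw [DomAddAct.mk_vadd_toLp, ← MemLp.toLp_sub, Lp.norm_toLp]
    rfl
  simp only [heq] at h0
  simpa using h0

variable {X Xt U₁ U₂ Xm V : Type*}
    [NormedAddCommGroup X] [NormedSpace ℝ X]
    [NormedAddCommGroup Xt] [NormedSpace ℝ Xt]
    [NormedAddCommGroup U₁] [NormedSpace ℝ U₁]
    [NormedAddCommGroup U₂] [NormedSpace ℝ U₂]
    [NormedAddCommGroup Xm] [NormedSpace ℝ Xm]
    [NormedAddCommGroup V] [NormedSpace ℝ V]
    {T : C0Semigroup X} {E : Extrapolation Xm T} {p q : ℝ}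

/-- Admissibility on a window of length `τ` ending at an arbitrary time `t`. -/
theorem IsLpAdmissibleFor.window {B : V →L[ℝ] Xm} {C : ℝ → ℝ}
    (hB : IsLpAdmissibleFor (fun t => E.Tm t) E.ι p B C) (hp : 1 ≤ p)
    {τ : ℝ} (hτ : 0 < τ) (t : ℝ) {g : ℝ → V} (hg : MemLp g (ENNReal.ofReal p) volume) :
    IntegrableOn (fun s => E.Tm (t - s) (B (g s))) (Ioo (t - τ) t) ∧
    ∃ y : X, E.ι y = (∫ s in Ioo (t - τ) t, E.Tm (t - s) (B (g s))) ∧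
      ‖y‖ ≤ |C τ| * (eLpNorm g (ENNReal.ofReal p) volume).toReal := by
  have hp0 : 0 < p := by linarith
  have hP0 : ENNReal.ofReal p ≠ 0 := by simpa using hp0
  have hPr : (ENNReal.ofReal p).toReal = p := ENNReal.toReal_ofReal hp0.le
  have hmp := measurePreserving_add_right (volume : Measure ℝ) (t - τ)
  have hme : MeasurableEmbedding (fun s : ℝ => s + (t - τ)) := measurableEmbedding_addRight _
  have hgu : MemLp (fun s => g (s + (t - τ))) (ENNReal.ofReal p) volume :=
    hg.comp_measurePreserving hmp
  have hgur := hgu.mono_measure (Measure.restrict_le_self (s := Ioo 0 τ))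
  have hpre : (fun s : ℝ => s + (t - τ)) ⁻¹' (Ioo (t - τ) t) = Ioo 0 τ := by
    ext s; simp only [mem_preimage, mem_Ioo]
    constructor <;> rintro ⟨h1, h2⟩ <;> constructor <;> linarith
  obtain ⟨hi, y, hy, hyn⟩ := hB τ hτ (fun s => g (s + (t - τ))) hgur.aestronglyMeasurable
    (by simpa only [hPr, IntegrableOn] using hgur.integrable_norm_rpow hP0 ENNReal.ofReal_ne_top)
  have hfun : (fun s => E.Tm (τ - s) (B (g (s + (t - τ))))) =
      (fun s => E.Tm (t - s) (B (g s))) ∘ (fun s => s + (t - τ)) := by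
    ext s
    simp only [Function.comp]
    rw [show t - (s + (t - τ)) = τ - s by ring]
  refine ⟨?_, y, ?_, hyn.trans ?_⟩
  · rw [← hmp.integrableOn_comp_preimage hme, hpre, ← hfun]
    exact hi
  · rw [hy, ← hmp.setIntegral_preimage_emb hme _ (Ioo (t - τ) t), hpre]
    exact congrArg (fun f => ∫ s in Ioo 0 τ, f s) hfun
  · have h1 : (∫ s in Ioo 0 τ, ‖g (s + (t - τ))‖ ^ p) ^ (1 / p) =
        (eLpNorm (fun s => g (s + (t - τ))) (ENNReal.ofReal p)
          (volume.restrict (Ioo 0 τ))).toReal := by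
      rw [hgur.eLpNorm_eq_integral_rpow_norm hP0 ENNReal.ofReal_ne_top, hPr, one_div,
        ENNReal.toReal_ofReal (by positivity)]
    rw [h1]
    have h2 : eLpNorm (fun s => g (s + (t - τ))) (ENNReal.ofReal p) volume =
        eLpNorm g (ENNReal.ofReal p) volume :=
      eLpNorm_comp_measurePreserving hg.aestronglyMeasurable hmp
    gcongr
    · exact le_abs_self _
    · exact hg.eLpNorm_ne_top
    · rw [← h2]
      exact eLpNorm_mono_measure _ Measure.restrict_le_self

/-- Admissibility on an arbitrary interval `(a, t)` of length at most `τ`. -/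
theorem IsLpAdmissibleFor.interval {B : V →L[ℝ] Xm} {C : ℝ → ℝ}
    (hB : IsLpAdmissibleFor (fun t => E.Tm t) E.ι p B C) (hp : 1 ≤ p)
    {τ a t : ℝ} (hτ : 0 < τ) (hat : t - a ≤ τ) {g : ℝ → V}
    (hg : MemLp g (ENNReal.ofReal p) (volume.restrict (Ioo a t))) :
    IntegrableOn (fun s => E.Tm (t - s) (B (g s))) (Ioo a t) ∧
    ∃ y : X, E.ι y = (∫ s in Ioo a t, E.Tm (t - s) (B (g s))) ∧
      ‖y‖ ≤ |C τ| * (eLpNorm g (ENNReal.ofReal p) (volume.restrict (Ioo a t))).toReal := by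
  have hg' : MemLp ((Ioo a t).indicator g) (ENNReal.ofReal p) volume :=
    (memLp_indicator_iff_restrict measurableSet_Ioo).2 hg
  obtain ⟨hi, y, hy, hyn⟩ := hB.window hp hτ t hg'
  have hfun : (fun s => E.Tm (t - s) (B ((Ioo a t).indicator g s))) =
      (Ioo a t).indicator (fun s => E.Tm (t - s) (B (g s))) := by
    ext s
    by_cases hs : s ∈ Ioo a t <;> simp [hs]
  have hsub : Ioo a t ⊆ Ioo (t - τ) t := Ioo_subset_Ioo_left (by linarith)
  rw [eLpNorm_indicator_eq_eLpNorm_restrict measurableSet_Ioo] at hyn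
  rw [hfun] at hi
  simp only [hfun] at hy
  rw [setIntegral_indicator measurableSet_Ioo, inter_eq_self_of_subset_right hsub] at hy
  refine ⟨?_, y, hy, hyn⟩
  have := hi.mono_set hsub
  rwa [integrableOn_indicator_iff measurableSet_Ioo, inter_self] at this

/-- The input map `t ↦ ∫ₐᵗ T₋₁(t-s) B g(s) ds` is continuous with values in `X`. -/
theorem IsLpAdmissibleFor.continuousOn {B : V →L[ℝ] Xm} {C : ℝ → ℝ}
    (hB : IsLpAdmissibleFor (fun t => E.Tm t) E.ι p B C) (hp : 1 ≤ p)
    {a b : ℝ} {g : ℝ → V}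
    (hg : MemLp g (ENNReal.ofReal p) (volume.restrict (Ioo a b))) {y : ℝ → X}
    (hy : ∀ t ∈ Icc a b, E.ι (y t) = ∫ s in Ioo a t, E.Tm (t - s) (B (g s))) :
    ContinuousOn y (Icc a b) := by
  rcases lt_or_ge b a with hab | hab
  · simp [Icc_eq_empty hab.not_ge]
  set τ := b - a + 1
  have hτ : 0 < τ := by simp only [τ]; linarith
  set G := (Ioo a b).indicator g
  have hG : MemLp G (ENNReal.ofReal p) volume :=
    (memLp_indicator_iff_restrict measurableSet_Ioo).2 hg
  have hyG : ∀ t ∈ Icc a b, E.ι (y t) = ∫ s in Ioo (t - τ) t, E.Tm (t - s) (B (G s)) := by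
    intro t ht
    rw [hy t ht]
    have hfun : (fun s => E.Tm (t - s) (B (G s))) =
        (Ioo a b).indicator (fun s => E.Tm (t - s) (B (g s))) := by
      ext s
      by_cases hs : s ∈ Ioo a b <;> simp [G, hs]
    rw [hfun, setIntegral_indicator measurableSet_Ioo]
    congr 2
    ext s
    simp only [mem_Ioo, mem_inter_iff, τ]
    constructor
    · rintro ⟨h1, h2⟩
      exact ⟨⟨by linarith [ht.2], h2⟩, h1, h2.trans_le ht.2⟩
    · rintro ⟨⟨h1, h2⟩, h3, h4⟩
      exact ⟨h3, h2⟩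
  intro t ht
  rw [ContinuousWithinAt, tendsto_iff_norm_sub_tendsto_zero]
  have hlim : Tendsto (fun t' : ℝ => |C τ| *
      (eLpNorm (fun s => G (t' - t + s) - G s) (ENNReal.ofReal p) volume).toReal)
      (𝓝[Icc a b] t) (𝓝 0) := by
    have h1 := tendsto_eLpNorm_translate_sub (by simpa using hp) ENNReal.ofReal_ne_top hG
    have h2 : Tendsto (fun t' : ℝ => t' - t) (𝓝[Icc a b] t) (𝓝 0) := by
      have : Tendsto (fun t' : ℝ => t' - t) (𝓝 t) (𝓝 (t - t)) :=
        (continuous_id.sub continuous_const).tendsto t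
      rw [sub_self] at this
      exact this.mono_left nhdsWithin_le_nhds
    simpa using (h1.comp h2).const_mul |C τ|
  refine squeeze_zero' (Eventually.of_forall fun _ => norm_nonneg _) ?_ hlim
  filter_upwards [self_mem_nhdsWithin] with t' ht'
  have hmp := measurePreserving_add_left (volume : Measure ℝ) (t' - t)
  have hme : MeasurableEmbedding (fun s : ℝ => t' - t + s) := measurableEmbedding_addLeft _
  have hGt : MemLp (fun s => G (t' - t + s)) (ENNReal.ofReal p) volume :=
    hG.comp_measurePreserving hmp
  obtain ⟨-, z, hz, hzn⟩ := hB.window hp hτ t (hGt.sub hG)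
  have hpre : (fun s : ℝ => t' - t + s) ⁻¹' (Ioo (t' - τ) t') = Ioo (t - τ) t := by
    ext s; simp only [mem_preimage, mem_Ioo]
    constructor <;> rintro ⟨h1, h2⟩ <;> constructor <;> linarith
  have hshift : ∫ s in Ioo (t' - τ) t', E.Tm (t' - s) (B (G s)) =
      ∫ s in Ioo (t - τ) t, E.Tm (t - s) (B (G (t' - t + s))) := by
    rw [← hmp.setIntegral_preimage_emb hme _ (Ioo (t' - τ) t'), hpre]
    congr 1
    ext s
    rw [show t' - (t' - t + s) = t - s by ring]
  have : y t' - y t = z := by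
    apply E.ι_injective
    rw [map_sub, hyG t' ht', hyG t ht, hz, hshift,
      ← integral_sub (hB.window hp hτ t hGt).1 (hB.window hp hτ t hG).1]
    simp
  rw [this]
  exact hzn

/-- A `C₀`-semigroup is bounded on `[0, 1]`. -/
theorem C0Semigroup.exists_norm_le [CompleteSpace X] (T : C0Semigroup X) :
    ∃ M : ℝ, 0 ≤ M ∧ ∀ t ∈ Icc (0 : ℝ) 1, ‖T t‖ ≤ M := by
  obtain ⟨M, hM⟩ := banach_steinhaus (g := fun t : Icc (0 : ℝ) 1 => T t) (by
    intro x
    obtain ⟨K, hK⟩ := isCompact_Icc.exists_bound_of_continuousOn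
      ((T.continuousOn_apply' x).mono (Icc_subset_Ici_self : Icc (0 : ℝ) 1 ⊆ _))
    exact ⟨K, fun t => hK t t.2⟩)
  exact ⟨M, (norm_nonneg _).trans (hM ⟨0, by simp⟩), fun t ht => hM ⟨t, ht⟩⟩

/-- Absolute continuity of the `L^p`-norm over short intervals. -/
theorem exists_eLpNorm_Ioo_le {W : Type*} [NormedAddCommGroup W] {p : ℝ} (hp : 1 ≤ p) {g : ℝ → W}
    (hg : MemLp g (ENNReal.ofReal p) (volume.restrict (Ioi 0))) {ε : ℝ} (hε : 0 < ε) :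
    ∃ δ > 0, ∀ a b : ℝ, 0 ≤ a → b - a ≤ δ →
      (eLpNorm g (ENNReal.ofReal p) (volume.restrict (Ioo a b))).toReal ≤ ε := by
  obtain ⟨δ, hδ, h⟩ := hg.eLpNorm_indicator_le (by simpa using hp) ENNReal.ofReal_ne_top hε
  refine ⟨δ, hδ, fun a b ha hab => ?_⟩
  have hsub : Ioo a b ⊆ Ioi 0 := fun s hs => ha.trans_lt hs.1
  have := h (Ioo a b) measurableSet_Ioo (by
    refine (Measure.restrict_apply_le _ _).trans ?_
    rw [Real.volume_Ioo]
    exact ENNReal.ofReal_le_ofReal hab)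
  rw [eLpNorm_indicator_eq_eLpNorm_restrict measurableSet_Ioo,
    Measure.restrict_restrict measurableSet_Ioo, inter_eq_self_of_subset_left hsub] at this
  exact ENNReal.toReal_le_of_le_ofReal hε.le this

/-- A pointwise bound on `(a, b)` gives a bound of the `L^p`-norms. -/
theorem toReal_eLpNorm_Ioo_le {W W' : Type*} [NormedAddCommGroup W] [NormedAddCommGroup W']
    {P : ℝ≥0∞} {f : ℝ → W} {g : ℝ → W'} {a b c : ℝ} (hc : 0 ≤ c)
    (hg : MemLp g P (volume.restrict (Ioo a b))) (h : ∀ s ∈ Ioo a b, ‖f s‖ ≤ c * ‖g s‖) :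
    (eLpNorm f P (volume.restrict (Ioo a b))).toReal ≤
      c * (eLpNorm g P (volume.restrict (Ioo a b))).toReal := by
  have h1 := eLpNorm_le_mul_eLpNorm_of_ae_le_mul (μ := volume.restrict (Ioo a b))
    ((ae_restrict_iff' measurableSet_Ioo).2 (Eventually.of_forall h)) P
  have h2 := ENNReal.toReal_mono
    (ENNReal.mul_ne_top ENNReal.ofReal_ne_top hg.eLpNorm_ne_top) h1
  rwa [ENNReal.toReal_mul, ENNReal.toReal_ofReal hc] at h2

/-- The nonlinearity maps a continuous function and an `L^p` input to an `L^p` function. -/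
theorem StandingAssumptions.memLp {m : ℝ} {F : X → U₁ → Xt} (hF : StandingAssumptions m F)
    (hm : 0 < m) {P : ℝ≥0∞} {a b : ℝ} {y : ℝ → X} (hy : ContinuousOn y (Icc a b)) {u : ℝ → U₁}
    (hu : MemLp u P (volume.restrict (Ioo a b))) :
    MemLp (fun s => F (y s) (u s)) P (volume.restrict (Ioo a b)) := by
  rcases lt_or_ge b a with hab | hab
  · simp [Ioo_eq_empty hab.not_gt]
  have hcont : Continuous (IccExtend hab ((Icc a b).domRestrict y)) :=
    (continuousOn_iff_continuous_domRestrict.1 hy).Icc_extend'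
  obtain ⟨v, hv, huv⟩ := hu.aestronglyMeasurable
  have hmeas : AEStronglyMeasurable (fun s => F (y s) (u s)) (volume.restrict (Ioo a b)) := by
    refine ⟨_, hF.stronglyMeasurable_comp _ v hcont.stronglyMeasurable hv, ?_⟩
    filter_upwards [huv, ae_restrict_mem measurableSet_Ioo] with s hs hsab
    rw [IccExtend_of_mem _ _ (Ioo_subset_Icc_self hsab), hs]
    rfl
  obtain ⟨K, hK⟩ := isCompact_Icc.exists_bound_of_continuousOn hy
  refine hu.of_le_mul (c := m * K) hmeas ?_
  filter_upwards [ae_restrict_mem measurableSet_Ioo] with s hs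
  refine (hF.norm_bound _ _).trans ?_
  gcongr
  exact hK s (Ioo_subset_Icc_self hs)

/-- The semigroup law splits a Duhamel integral at an intermediate time. -/
theorem Extrapolation.setIntegral_split [CompleteSpace Xm] (E : Extrapolation Xm T)
    {w : ℝ → Xm} {t₀ a t : ℝ} (h₀ : t₀ ≤ a) (hat : a ≤ t)
    (hit : IntegrableOn (fun s => E.Tm (t - s) (w s)) (Ioo t₀ t))
    (hia : IntegrableOn (fun s => E.Tm (a - s) (w s)) (Ioo t₀ a)) :
    ∫ s in Ioo t₀ t, E.Tm (t - s) (w s) =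
      E.Tm (t - a) (∫ s in Ioo t₀ a, E.Tm (a - s) (w s)) +
        ∫ s in Ioo a t, E.Tm (t - s) (w s) := by
  rw [← ContinuousLinearMap.integral_comp_comm _ hia]
  have h1 : ∫ s in Ioo t₀ a, E.Tm (t - a) (E.Tm (a - s) (w s)) =
      ∫ s in Ioo t₀ a, E.Tm (t - s) (w s) := by
    refine setIntegral_congr_fun measurableSet_Ioo fun s hs => ?_
    have := E.Tm.map_add' (t - a) (a - s) (by linarith) (by linarith [hs.2])
    rw [show t - a + (a - s) = t - s by ring] at this
    simp only [this, ContinuousLinearMap.comp_apply]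
  rw [h1]
  rw [← integral_Ioc_eq_integral_Ioo (x := t₀) (y := t),
    ← integral_Ioc_eq_integral_Ioo (x := t₀) (y := a),
    ← integral_Ioc_eq_integral_Ioo (x := a) (y := t), ← Ioc_union_Ioc_eq_Ioc h₀ hat]
  have hit' : IntegrableOn (fun s => E.Tm (t - s) (w s)) (Ioc t₀ t) :=
    (integrableOn_Ioc_iff_integrableOn_Ioo).2 hit
  exact setIntegral_union (Ioc_disjoint_Ioc_of_le le_rfl) measurableSet_Ioc
    (hit'.mono_set (Ioc_subset_Ioc_right hat)) (hit'.mono_set (Ioc_subset_Ioc_left h₀))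

section Duhamel

variable {B₁ : Xt →L[ℝ] Xm} {B₂ : U₂ →L[ℝ] Xm} {C₁ C₂ : ℝ → ℝ}

/-- Integrability of a Duhamel integrand with two admissible inputs. -/
theorem integrableOn_duhamel (hB₁ : IsLpAdmissibleFor (fun t => E.Tm t) E.ι p B₁ C₁)
    (hB₂ : IsLpAdmissibleFor (fun t => E.Tm t) E.ι q B₂ C₂) (hp : 1 ≤ p) (hq : 1 ≤ q)
    {a t : ℝ} {f : ℝ → Xt} {g : ℝ → U₂}
    (hf : MemLp f (ENNReal.ofReal p) (volume.restrict (Ioo a t)))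
    (hg : MemLp g (ENNReal.ofReal q) (volume.restrict (Ioo a t))) :
    IntegrableOn (fun s => E.Tm (t - s) (B₁ (f s) + B₂ (g s))) (Ioo a t) := by
  have hτ : 0 < |t - a| + 1 := by positivity
  have hle : t - a ≤ |t - a| + 1 := by linarith [le_abs_self (t - a)]
  simp only [map_add]
  exact (hB₁.interval hp hτ hle hf).1.add (hB₂.interval hq hτ hle hg).1

/-- The Duhamel formula with admissible inputs defines a continuous `X`-valued function. -/
theorem exists_continuousOn_duhamel (hB₁ : IsLpAdmissibleFor (fun t => E.Tm t) E.ι p B₁ C₁)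
    (hB₂ : IsLpAdmissibleFor (fun t => E.Tm t) E.ι q B₂ C₂) (hp : 1 ≤ p) (hq : 1 ≤ q)
    {t₀ b : ℝ} (x₀ : X) {f : ℝ → Xt} {g : ℝ → U₂}
    (hf : MemLp f (ENNReal.ofReal p) (volume.restrict (Ioo t₀ b)))
    (hg : MemLp g (ENNReal.ofReal q) (volume.restrict (Ioo t₀ b))) :
    ∃ G : ℝ → X, ContinuousOn G (Icc t₀ b) ∧ ∀ t ∈ Icc t₀ b,
      E.ι (G t) = E.ι (T (t - t₀) x₀) +
        ∫ s in Ioo t₀ t, E.Tm (t - s) (B₁ (f s) + B₂ (g s)) := by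
  have hτ : 0 < |b - t₀| + 1 := by positivity
  have hle : ∀ t ∈ Icc t₀ b, t - t₀ ≤ |b - t₀| + 1 := fun t ht => by
    linarith [le_abs_self (b - t₀), ht.2]
  have hft (t : ℝ) (ht : t ∈ Icc t₀ b) :=
    hB₁.interval hp hτ (hle t ht)
      (hf.mono_measure (Measure.restrict_mono (Ioo_subset_Ioo_right ht.2) le_rfl))
  have hgt (t : ℝ) (ht : t ∈ Icc t₀ b) :=
    hB₂.interval hq hτ (hle t ht)
      (hg.mono_measure (Measure.restrict_mono (Ioo_subset_Ioo_right ht.2) le_rfl))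
  have hf' (t : ℝ) : ∃ y : X, t ∈ Icc t₀ b →
      E.ι y = ∫ s in Ioo t₀ t, E.Tm (t - s) (B₁ (f s)) := by
    by_cases ht : t ∈ Icc t₀ b
    · obtain ⟨-, y, hy, -⟩ := hft t ht
      exact ⟨y, fun _ => hy⟩
    · exact ⟨0, fun h => absurd h ht⟩
  have hg' (t : ℝ) : ∃ y : X, t ∈ Icc t₀ b →
      E.ι y = ∫ s in Ioo t₀ t, E.Tm (t - s) (B₂ (g s)) := by
    by_cases ht : t ∈ Icc t₀ b
    · obtain ⟨-, y, hy, -⟩ := hgt t ht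
      exact ⟨y, fun _ => hy⟩
    · exact ⟨0, fun h => absurd h ht⟩
  choose Y hY using hf'
  choose Z hZ using hg'
  have hT : ContinuousOn (fun t => T (t - t₀) x₀) (Icc t₀ b) :=
    (T.continuousOn_apply' x₀).comp (continuous_sub_right t₀).continuousOn
      fun t ht => sub_nonneg.2 ht.1
  refine ⟨fun t => T (t - t₀) x₀ + (Y t + Z t),
    hT.add ((hB₁.continuousOn hp hf hY).add (hB₂.continuousOn hq hg hZ)), fun t ht => ?_⟩
  rw [map_add, map_add, hY t ht, hZ t ht,
    ← integral_add (hft t ht).1 (hgt t ht).1]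
  simp only [map_add]

/-- Growth bound for a function given by the Duhamel formula, over a short time step. -/
theorem norm_duhamel_le [CompleteSpace Xm]
    (hB₁ : IsLpAdmissibleFor (fun t => E.Tm t) E.ι p B₁ C₁)
    (hB₂ : IsLpAdmissibleFor (fun t => E.Tm t) E.ι q B₂ C₂) (hp : 1 ≤ p) (hq : 1 ≤ q)
    {t₀ a t M : ℝ} {x₀ : X} (h₀ : t₀ ≤ a) (hat : a ≤ t) (ht : t - a ≤ 1)
    (hM : ∀ r ∈ Icc (0 : ℝ) 1, ‖T r‖ ≤ M) {f : ℝ → Xt} {g : ℝ → U₂}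
    (hf : MemLp f (ENNReal.ofReal p) (volume.restrict (Ioo t₀ t)))
    (hg : MemLp g (ENNReal.ofReal q) (volume.restrict (Ioo t₀ t))) {ya yt : X}
    (hya : E.ι ya = E.ι (T (a - t₀) x₀) +
      ∫ s in Ioo t₀ a, E.Tm (a - s) (B₁ (f s) + B₂ (g s)))
    (hyt : E.ι yt = E.ι (T (t - t₀) x₀) +
      ∫ s in Ioo t₀ t, E.Tm (t - s) (B₁ (f s) + B₂ (g s))) :
    ‖yt‖ ≤ M * ‖ya‖ +
      |C₁ 1| * (eLpNorm f (ENNReal.ofReal p) (volume.restrict (Ioo a t))).toReal +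
      |C₂ 1| * (eLpNorm g (ENNReal.ofReal q) (volume.restrict (Ioo a t))).toReal := by
  have hsubl : Ioo t₀ a ⊆ Ioo t₀ t := Ioo_subset_Ioo_right hat
  have hsubr : Ioo a t ⊆ Ioo t₀ t := Ioo_subset_Ioo_left h₀
  obtain ⟨hi₁, y₁, hy₁, hn₁⟩ := hB₁.interval hp one_pos ht
    (hf.mono_measure (Measure.restrict_mono hsubr le_rfl))
  obtain ⟨hi₂, y₂, hy₂, hn₂⟩ := hB₂.interval hq one_pos ht
    (hg.mono_measure (Measure.restrict_mono hsubr le_rfl))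
  have hsplit := E.setIntegral_split h₀ hat (integrableOn_duhamel hB₁ hB₂ hp hq hf hg)
    (integrableOn_duhamel hB₁ hB₂ hp hq (hf.mono_measure (Measure.restrict_mono hsubl le_rfl))
      (hg.mono_measure (Measure.restrict_mono hsubl le_rfl)))
  have hT : T (t - t₀) x₀ = T (t - a) (T (a - t₀) x₀) := by
    have := T.map_add' (t - a) (a - t₀) (by linarith) (by linarith)
    rw [show t - a + (a - t₀) = t - t₀ by ring] at this
    simp [this]
  have hrep : yt = T (t - a) ya + y₁ + y₂ := by
    apply E.ι_injective
    rw [hyt, hsplit, hT, ← E.compat (t - a) (by linarith) (T (a - t₀) x₀), map_add, map_add,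
      ← E.compat (t - a) (by linarith) ya, hya, map_add, hy₁, hy₂, add_assoc, add_assoc, ← integral_add hi₁ hi₂]
    simp only [map_add]
  rw [hrep]
  refine (norm_add₃_le).trans ?_
  gcongr
  exact (T (t - a)).le_of_opNorm_le (hM _ ⟨by linarith, ht⟩) _

/-- Two functions given by the Duhamel formula with forcings that agree up to time `a`
differ at time `t` by the `L^p`-norm of the difference of the forcings over `(a, t)`. -/
theorem norm_duhamel_sub_le (hB₁ : IsLpAdmissibleFor (fun t => E.Tm t) E.ι p B₁ C₁)
    (hB₂ : IsLpAdmissibleFor (fun t => E.Tm t) E.ι q B₂ C₂) (hp : 1 ≤ p) (hq : 1 ≤ q)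
    {t₀ a t : ℝ} {x₀ : X} (h₀ : t₀ ≤ a) (ht : t - a ≤ 1)
    {f f' : ℝ → Xt} {g : ℝ → U₂}
    (hf : MemLp f (ENNReal.ofReal p) (volume.restrict (Ioo t₀ t)))
    (hf' : MemLp f' (ENNReal.ofReal p) (volume.restrict (Ioo t₀ t)))
    (hff' : ∀ s ∈ Icc t₀ a, f s = f' s)
    (hg : MemLp g (ENNReal.ofReal q) (volume.restrict (Ioo t₀ t))) {y z : X}
    (hy : E.ι y = E.ι (T (t - t₀) x₀) +
      ∫ s in Ioo t₀ t, E.Tm (t - s) (B₁ (f s) + B₂ (g s)))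
    (hz : E.ι z = E.ι (T (t - t₀) x₀) +
      ∫ s in Ioo t₀ t, E.Tm (t - s) (B₁ (f' s) + B₂ (g s))) :
    ‖y - z‖ ≤ |C₁ 1| *
      (eLpNorm (fun s => f s - f' s) (ENNReal.ofReal p) (volume.restrict (Ioo a t))).toReal := by
  have hsub : Ioo a t ⊆ Ioo t₀ t := Ioo_subset_Ioo_left h₀
  obtain ⟨-, w, hw, hn⟩ := hB₁.interval hp one_pos ht
    ((hf.sub hf').mono_measure (Measure.restrict_mono hsub le_rfl))
  have hrep : y - z = w := by
    apply E.ι_injective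
    rw [map_sub, hy, hz, hw, add_sub_add_left_eq_sub,
      ← integral_sub (integrableOn_duhamel hB₁ hB₂ hp hq hf hg)
        (integrableOn_duhamel hB₁ hB₂ hp hq hf' hg)]
    have hfun : (fun s => E.Tm (t - s) (B₁ (f s) + B₂ (g s)) -
        E.Tm (t - s) (B₁ (f' s) + B₂ (g s))) = fun s => E.Tm (t - s) (B₁ ((f - f') s)) := by
      ext s
      rw [← map_sub, add_sub_add_right_eq_sub, ← map_sub]
      rfl
    rw [hfun]
    refine setIntegral_eq_of_subset_of_forall_sdiff_eq_zero measurableSet_Ioo hsub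
      fun s hs => ?_
    have hsa : s ≤ a := by
      by_contra! h
      exact hs.2 ⟨h, hs.1.2⟩
    simp [hff' s ⟨hs.1.1.le, hsa⟩]
  rw [hrep]
  exact hn

end Duhamel

section MildSolution

variable {B₁ : Xt →L[ℝ] Xm} {B₂ : U₂ →L[ℝ] Xm} {C₁ C₂ : ℝ → ℝ} {m : ℝ} {F : X → U₁ → Xt}
    {t₀ : ℝ} {x₀ : X} {u₁ : ℝ → U₁} {u₂ : ℝ → U₂}

theorem IsMildSolutionOn.mono {a b : ℝ} {x : ℝ → X}
    (hx : IsMildSolutionOn T E B₁ B₂ F x₀ u₁ u₂ t₀ b x) (hab : a ≤ b) :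
    IsMildSolutionOn T E B₁ B₂ F x₀ u₁ u₂ t₀ a x :=
  ⟨hx.1.mono (Icc_subset_Icc_right hab), fun t ht => hx.2 t ⟨ht.1, ht.2.trans hab⟩⟩

theorem mul_mul_one_div_le {c d D : ℝ} (hc : 0 ≤ c) (hd : 0 ≤ d) (hD : d ≤ D) :
    c * (d * (1 / (2 * (c + 1) * (D + 1)))) ≤ 1 / 2 := by
  have hD0 : 0 ≤ D := hd.trans hD
  rw [mul_one_div, mul_div_assoc', div_le_div_iff₀ (by positivity) (by norm_num)]
  have : c * d ≤ c * D := mul_le_mul_of_nonneg_left hD hc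
  nlinarith

/-- Two Duhamel functions with forcings `F(y, u₁)` and `F(z, u₁)` that agree up to time `a`
differ by at most half the distance of `y` and `z`, as long as `u₁` is small on `(a, t)`. -/
theorem norm_duhamel_sub_le_half (hB₁ : IsLpAdmissibleFor (fun t => E.Tm t) E.ι p B₁ C₁)
    (hB₂ : IsLpAdmissibleFor (fun t => E.Tm t) E.ι q B₂ C₂) (hp : 1 ≤ p) (hq : 1 ≤ q)
    (hm : 0 < m) (hF : StandingAssumptions m F)
    (hu₁ : MemLp u₁ (ENNReal.ofReal p) (volume.restrict (Ioi 0)))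
    (hu₂ : MemLp u₂ (ENNReal.ofReal q) (volume.restrict (Ioi 0)))
    (ht₀ : 0 ≤ t₀) {a t K L ε D : ℝ} (h₀ : t₀ ≤ a) (ht : t - a ≤ 1)
    (hL : 0 ≤ L) (hD : 0 ≤ D)
    (hLip : ∀ x ∈ Metric.closedBall (0 : X) K, ∀ y ∈ Metric.closedBall (0 : X) K,
      ∀ u, ‖F x u - F y u‖ ≤ L * ‖u‖ * ‖x - y‖)
    (hε : |C₁ 1| * (L * ε) ≤ 1 / 2)
    (hu : (eLpNorm u₁ (ENNReal.ofReal p) (volume.restrict (Ioo a t))).toReal ≤ ε)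
    {y z : ℝ → X} (hyc : ContinuousOn y (Icc t₀ t)) (hzc : ContinuousOn z (Icc t₀ t))
    (hyz : ∀ s ∈ Icc t₀ a, y s = z s)
    (hyK : ∀ s ∈ Icc a t, ‖y s‖ ≤ K) (hzK : ∀ s ∈ Icc a t, ‖z s‖ ≤ K)
    (hyzD : ∀ s ∈ Icc a t, ‖y s - z s‖ ≤ D) {v w : X}
    (hv : E.ι v = E.ι (T (t - t₀) x₀) +
      ∫ s in Ioo t₀ t, E.Tm (t - s) (B₁ (F (y s) (u₁ s)) + B₂ (u₂ s)))
    (hw : E.ι w = E.ι (T (t - t₀) x₀) +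
      ∫ s in Ioo t₀ t, E.Tm (t - s) (B₁ (F (z s) (u₁ s)) + B₂ (u₂ s))) :
    ‖v - w‖ ≤ 1 / 2 * D := by
  have hsub : Ioo t₀ t ⊆ Ioi 0 := fun s hs => ht₀.trans_lt hs.1
  have hu₁' := hu₁.mono_measure (Measure.restrict_mono hsub (le_refl volume))
  have hsub' : Ioo a t ⊆ Ioi 0 := fun s hs => (ht₀.trans h₀).trans_lt hs.1
  refine (norm_duhamel_sub_le hB₁ hB₂ hp hq h₀ ht (hF.memLp hm hyc hu₁') (hF.memLp hm hzc hu₁')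
    (fun s hs => by rw [hyz s hs])
    (hu₂.mono_measure (Measure.restrict_mono hsub le_rfl)) hv hw).trans ?_
  have h1 : (eLpNorm (fun s => F (y s) (u₁ s) - F (z s) (u₁ s)) (ENNReal.ofReal p)
      (volume.restrict (Ioo a t))).toReal ≤ L * D *
      (eLpNorm u₁ (ENNReal.ofReal p) (volume.restrict (Ioo a t))).toReal := by
    refine toReal_eLpNorm_Ioo_le (mul_nonneg hL hD)
      (hu₁.mono_measure (Measure.restrict_mono hsub' le_rfl)) fun s hs => ?_
    have hs' := Ioo_subset_Icc_self hs
    refine (hLip _ (by simpa using hyK s hs') _ (by simpa using hzK s hs') _).trans ?_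
    calc L * ‖u₁ s‖ * ‖y s - z s‖ ≤ L * ‖u₁ s‖ * D := by gcongr; exact hyzD s hs'
      _ = L * D * ‖u₁ s‖ := by ring
  calc _ ≤ |C₁ 1| * (L * D * ε) := by gcongr; exact h1.trans (by gcongr)
    _ = |C₁ 1| * (L * ε) * D := by ring
    _ ≤ 1 / 2 * D := by gcongr

/-- Mild solutions are unique. -/
theorem IsMildSolutionOn.eqOn (hB₁ : IsLpAdmissibleFor (fun t => E.Tm t) E.ι p B₁ C₁)
    (hB₂ : IsLpAdmissibleFor (fun t => E.Tm t) E.ι q B₂ C₂) (hp : 1 ≤ p) (hq : 1 ≤ q)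
    (hm : 0 < m) (hF : StandingAssumptions m F)
    (hu₁ : MemLp u₁ (ENNReal.ofReal p) (volume.restrict (Ioi 0)))
    (hu₂ : MemLp u₂ (ENNReal.ofReal q) (volume.restrict (Ioi 0)))
    (ht₀ : 0 ≤ t₀) {b : ℝ} {x z : ℝ → X}
    (hx : IsMildSolutionOn T E B₁ B₂ F x₀ u₁ u₂ t₀ b x)
    (hz : IsMildSolutionOn T E B₁ B₂ F x₀ u₁ u₂ t₀ b z) : EqOn x z (Icc t₀ b) := by
  obtain ⟨K₁, hK₁⟩ := isCompact_Icc.exists_bound_of_continuousOn hx.1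
  obtain ⟨K₂, hK₂⟩ := isCompact_Icc.exists_bound_of_continuousOn hz.1
  obtain ⟨L, hL, hLip⟩ := hF.lipschitz _ (Metric.isBounded_closedBall (x := (0 : X))
    (r := max K₁ K₂))
  obtain ⟨δ', hδ', hu⟩ := exists_eLpNorm_Ioo_le hp hu₁
    (ε := 1 / (2 * (|C₁ 1| + 1) * (L + 1))) (by positivity)
  set δ := min δ' 1
  have hδ : 0 < δ := lt_min hδ' one_pos
  have hstep (n : ℕ) : EqOn x z (Icc t₀ (min (t₀ + n * δ) b)) := by
    induction n with
    | zero =>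
      intro t ht
      have htt : t = t₀ := le_antisymm (ht.2.trans (by simp)) ht.1
      have htb : t ∈ Icc t₀ b := ⟨ht.1, ht.2.trans (min_le_right _ _)⟩
      apply E.ι_injective
      rw [(hx.2 t htb).2, (hz.2 t htb).2, htt, Ioo_self]
      simp
    | succ n ih =>
      intro r hr
      set a := min (t₀ + n * δ) b
      rcases le_or_gt r a with hra | hra
      · exact ih ⟨hr.1, hra⟩
      have hrb : r ≤ b := hr.2.trans (min_le_right _ _)
      have ha : t₀ ≤ a := le_min (by simpa using by positivity) (hr.1.trans hrb)
      have hrδ : r - a ≤ δ := by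
        have h1 : r ≤ t₀ + (n + 1 : ℕ) * δ := hr.2.trans (min_le_left _ _)
        push_cast at h1
        rcases min_choice (t₀ + n * δ) b with h | h <;> simp only [a] at hra ⊢ <;>
          rw [h] at hra ⊢ <;> linarith
      have hsub : Icc a r ⊆ Icc t₀ b := Icc_subset_Icc ha hrb
      obtain ⟨s, hs, hmax⟩ := isCompact_Icc.exists_isMaxOn (nonempty_Icc.2 hra.le)
        ((hx.1.mono hsub).sub (hz.1.mono hsub)).norm
      have hsub' : Icc a s ⊆ Icc a r := Icc_subset_Icc_right hs.2
      have hst : Icc t₀ s ⊆ Icc t₀ b := Icc_subset_Icc_right (hsub hs).2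
      have hhalf := norm_duhamel_sub_le_half hB₁ hB₂ hp hq hm hF hu₁ hu₂ ht₀ ha
        (by linarith [hs.2, min_le_right δ' 1]) hL.le (norm_nonneg (x s - z s)) hLip
        (mul_mul_one_div_le (abs_nonneg _) hL.le le_rfl)
        (hu a s (ht₀.trans ha) (by linarith [hs.2, min_le_left δ' 1]))
        (hx.1.mono hst) (hz.1.mono hst) ih
        (fun i hi => (hK₁ i (hsub (hsub' hi))).trans (le_max_left _ _))
        (fun i hi => (hK₂ i (hsub (hsub' hi))).trans (le_max_right _ _))
        (fun i hi => hmax (hsub' hi))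
        (hx.2 s (hsub hs)).2 (hz.2 s (hsub hs)).2
      have hzero : ‖x s - z s‖ ≤ 0 := by linarith
      have := (hmax (right_mem_Icc.2 hra.le)).trans hzero
      exact sub_eq_zero.1 (norm_le_zero_iff.1 this)
  intro t ht
  obtain ⟨n, hn⟩ := exists_nat_ge ((t - t₀) / δ)
  refine hstep n ⟨ht.1, le_min ?_ ht.2⟩
  rw [div_le_iff₀ hδ] at hn
  linarith

/-- A mild solution can be extended by a time step that depends only on a bound for its
final value. -/
theorem exists_forall_isMildSolutionOn_add [CompleteSpace X] [CompleteSpace Xm]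
    (hB₁ : IsLpAdmissibleFor (fun t => E.Tm t) E.ι p B₁ C₁)
    (hB₂ : IsLpAdmissibleFor (fun t => E.Tm t) E.ι q B₂ C₂) (hp : 1 ≤ p) (hq : 1 ≤ q)
    (hm : 0 < m) (hF : StandingAssumptions m F)
    (hu₁ : MemLp u₁ (ENNReal.ofReal p) (volume.restrict (Ioi 0)))
    (hu₂ : MemLp u₂ (ENNReal.ofReal q) (volume.restrict (Ioi 0)))
    (ht₀ : 0 ≤ t₀) {R : ℝ} (hR : 0 ≤ R) :
    ∃ δ > 0, ∀ a, t₀ ≤ a → ∀ x : ℝ → X, IsMildSolutionOn T E B₁ B₂ F x₀ u₁ u₂ t₀ a x →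
      ‖x a‖ ≤ R → ∃ y, IsMildSolutionOn T E B₁ B₂ F x₀ u₁ u₂ t₀ (a + δ) y := by
  obtain ⟨M, hM0, hM⟩ := T.exists_norm_le
  set K := (M + 1) * R + 2
  have hK0 : 0 ≤ K := by positivity
  have hRK : R ≤ K := by simp only [K]; nlinarith [mul_nonneg hM0 hR]
  obtain ⟨L, hL, hLip⟩ := hF.lipschitz _ (Metric.isBounded_closedBall (x := (0 : X)) (r := K))
  have hmK : 0 ≤ m * K := by positivity
  obtain ⟨δ₁, hδ₁, hs₁⟩ := exists_eLpNorm_Ioo_le hp hu₁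
    (ε := 1 / (2 * (|C₁ 1| + 1) * ((m * K + L) + 1))) (by positivity)
  obtain ⟨δ₂, hδ₂, hs₂⟩ := exists_eLpNorm_Ioo_le hq hu₂
    (ε := 1 / (2 * (|C₂ 1| + 1) * (1 + 1))) (by positivity)
  set ε₁ := 1 / (2 * (|C₁ 1| + 1) * ((m * K + L) + 1))
  set ε₂ := 1 / (2 * (|C₂ 1| + 1) * (1 + 1))
  have hε₁K : |C₁ 1| * ((m * K) * ε₁) ≤ 1 / 2 :=
    mul_mul_one_div_le (abs_nonneg _) hmK (by linarith)
  have hε₁L : |C₁ 1| * (L * ε₁) ≤ 1 / 2 :=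
    mul_mul_one_div_le (abs_nonneg _) hL.le (by linarith)
  have hε₂ : |C₂ 1| * (1 * ε₂) ≤ 1 / 2 :=
    mul_mul_one_div_le (abs_nonneg _) zero_le_one le_rfl
  set δ := min (min δ₁ δ₂) 1
  have hδ : 0 < δ := lt_min (lt_min hδ₁ hδ₂) one_pos
  have hδ1 : δ ≤ 1 := min_le_right _ _
  have hδδ₁ : δ ≤ δ₁ := (min_le_left _ _).trans (min_le_left _ _)
  have hδδ₂ : δ ≤ δ₂ := (min_le_left _ _).trans (min_le_right _ _)
  refine ⟨δ, hδ, fun a ha x hx hxa => ?_⟩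
  set b := a + δ
  have hab : a ≤ b := by simp only [b]; linarith
  have htb : t₀ ≤ b := ha.trans hab
  have hsub (t : ℝ) : Ioo t₀ t ⊆ Ioi 0 := fun s hs => ht₀.trans_lt hs.1
  have hsuba (t : ℝ) : Ioo a t ⊆ Ioi 0 := fun s hs => (ht₀.trans ha).trans_lt hs.1
  have hu₁t (t : ℝ) := hu₁.mono_measure (Measure.restrict_mono (hsub t) (le_refl volume))
  have hu₂t (t : ℝ) := hu₂.mono_measure (Measure.restrict_mono (hsub t) (le_refl volume))
  let ext : C(Icc t₀ b, X) → ℝ → X := fun y => IccExtend htb y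
  have hext (y : C(Icc t₀ b, X)) : Continuous (ext y) := y.continuous.Icc_extend'
  have hext_apply (y : C(Icc t₀ b, X)) (t : ℝ) (ht : t ∈ Icc t₀ b) : ext y t = y ⟨t, ht⟩ :=
    IccExtend_of_mem htb y ht
  have hFy (y : C(Icc t₀ b, X)) (t : ℝ) := hF.memLp hm (hext y).continuousOn (hu₁t t)
  choose G hGc hG using fun y : C(Icc t₀ b, X) =>
    exists_continuousOn_duhamel hB₁ hB₂ hp hq x₀ (hFy y b) (hu₂t b)
  let Φ : C(Icc t₀ b, X) → C(Icc t₀ b, X) := fun y =>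
    ⟨(Icc t₀ b).domRestrict (G y), continuousOn_iff_continuous_domRestrict.1 (hGc y)⟩
  let S : Set C(Icc t₀ b, X) :=
    {y | (∀ t : Icc t₀ b, (t : ℝ) ≤ a → y t = x t) ∧ ∀ t : Icc t₀ b, a ≤ (t : ℝ) → ‖y t‖ ≤ K}
  have hSc : IsClosed S := by
    simp only [S, ofPred_and, ofPred_forall]
    exact (isClosed_iInter fun t => isClosed_iInter fun _ =>
      isClosed_eq (continuous_eval_const t) continuous_const).inter
      (isClosed_iInter fun t => isClosed_iInter fun _ =>
      isClosed_le (continuous_eval_const t).norm continuous_const)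
  have hSext {y : C(Icc t₀ b, X)} (hy : y ∈ S) : ∀ s ∈ Icc t₀ a, ext y s = x s := by
    intro s hs
    rw [hext_apply y s ⟨hs.1, hs.2.trans hab⟩]
    exact hy.1 ⟨s, _⟩ hs.2
  have hSK {y : C(Icc t₀ b, X)} (hy : y ∈ S) : ∀ s ∈ Icc a b, ‖ext y s‖ ≤ K := by
    intro s hs
    rw [hext_apply y s ⟨ha.trans hs.1, hs.2⟩]
    exact hy.2 ⟨s, _⟩ hs.1
  have hGx {y : C(Icc t₀ b, X)} (hy : y ∈ S) (t : ℝ) (ht : t ∈ Icc t₀ a) : G y t = x t := by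
    apply E.ι_injective
    rw [hG y t ⟨ht.1, ht.2.trans hab⟩, (hx.2 t ht).2]
    congr 1
    refine setIntegral_congr_fun measurableSet_Ioo fun s hs => ?_
    simp only [hSext hy s ⟨hs.1.le, hs.2.le.trans ht.2⟩]
  have hmaps : MapsTo Φ S S := by
    intro y hy
    refine ⟨fun t ht => hGx hy t ⟨t.2.1, ht⟩, fun t ht => ?_⟩
    have hta : (t : ℝ) - a ≤ δ := by linarith [t.2.2]
    have hle := norm_duhamel_le hB₁ hB₂ hp hq ha ht (hta.trans hδ1) hM (hFy y t) (hu₂t t)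
      (hG y a ⟨ha, hab⟩) (hG y t t.2)
    have h1 : (eLpNorm (fun s => F (ext y s) (u₁ s)) (ENNReal.ofReal p)
        (volume.restrict (Ioo a t))).toReal ≤ m * K * ε₁ := by
      refine (toReal_eLpNorm_Ioo_le hmK
        (hu₁.mono_measure (Measure.restrict_mono (hsuba t) le_rfl)) fun s hs => ?_).trans
        (mul_le_mul_of_nonneg_left (hs₁ a t (ht₀.trans ha) (hta.trans hδδ₁)) hmK)
      refine (hF.norm_bound _ _).trans ?_
      gcongr
      exact hSK hy s ⟨hs.1.le, hs.2.le.trans t.2.2⟩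
    have h2 := hs₂ a t (ht₀.trans ha) (hta.trans hδδ₂)
    rw [hGx hy a ⟨ha, le_rfl⟩] at hle
    have h3 := mul_le_mul_of_nonneg_left h1 (abs_nonneg (C₁ 1))
    have h4 := mul_le_mul_of_nonneg_left h2 (abs_nonneg (C₂ 1))
    have h5 := mul_le_mul_of_nonneg_left hxa hM0
    change ‖G y t‖ ≤ K
    rw [one_mul] at hε₂
    simp only [K] at *
    nlinarith
  have hcontr : ContractingWith (1 / 2) (hmaps.restrict Φ S S) := by
    refine ⟨by norm_num, LipschitzWith.of_dist_le_mul ?_⟩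
    rintro ⟨y, hy⟩ ⟨z, hz⟩
    change dist (Φ y) (Φ z) ≤ _ * dist y z
    refine (ContinuousMap.dist_le (by positivity)).2 fun t => ?_
    rcases le_total (t : ℝ) a with hta | hat
    · rw [(hmaps hy).1 t hta, (hmaps hz).1 t hta, dist_self]
      positivity
    have hta : (t : ℝ) - a ≤ δ := by linarith [t.2.2]
    rw [dist_eq_norm]
    have := norm_duhamel_sub_le_half hB₁ hB₂ hp hq hm hF hu₁ hu₂ ht₀ ha (hta.trans hδ1)
      hL.le (dist_nonneg (x := y) (y := z)) hLip hε₁L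
      (hs₁ a t (ht₀.trans ha) (hta.trans hδδ₁)) (hext y).continuousOn (hext z).continuousOn
      (fun s hs => (hSext hy s hs).trans (hSext hz s hs).symm)
      (fun s hs => hSK hy s ⟨hs.1, hs.2.trans t.2.2⟩)
      (fun s hs => hSK hz s ⟨hs.1, hs.2.trans t.2.2⟩)
      (fun s hs => by
        have hs' : s ∈ Icc t₀ b := ⟨ha.trans hs.1, hs.2.trans t.2.2⟩
        rw [hext_apply y s hs', hext_apply z s hs', ← dist_eq_norm]
        exact ContinuousMap.dist_apply_le_dist _)
      (hG y t t.2) (hG z t t.2)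
    change ‖G y t - G z t‖ ≤ _
    simpa using this
  let y₀ : C(Icc t₀ b, X) := ⟨fun t => x (min t a),
    hx.1.comp_continuous (by fun_prop) fun t => ⟨le_min t.2.1 ha, min_le_right _ _⟩⟩
  have hy₀ : y₀ ∈ S := by
    refine ⟨fun t ht => ?_, fun t ht => ?_⟩
    · simp [y₀, min_eq_left ht]
    · simpa [y₀, min_eq_right ht] using hxa.trans hRK
  obtain ⟨y, -, hfix, -⟩ := hcontr.exists_fixedPoint' hSc.isComplete hmaps hy₀ (edist_ne_top _ _)
  refine ⟨ext y, (hext y).continuousOn, fun t ht =>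
    ⟨integrableOn_duhamel hB₁ hB₂ hp hq (hFy y t) (hu₂t t), ?_⟩⟩
  rw [← hG y t ht, hext_apply y t ht]
  exact congrArg (fun f : C(Icc t₀ b, X) => E.ι (f ⟨t, ht⟩)) hfix.symm

end MildSolution

end Helpers

/-- Proposition (thm1), blow-up alternative: if the maximal existence time `tmax` of the
unique mild solution of `Σ(A,[B₁,B₂],F)` is finite, then the solution norm blows up as
`t → tmax⁻`. -/
theorem bilinear_blowup_alternative
    {X Xt U₁ U₂ Xm : Type*}
    [NormedAddCommGroup X] [NormedSpace ℝ X] [CompleteSpace X]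
    [NormedAddCommGroup Xt] [NormedSpace ℝ Xt] [CompleteSpace Xt]
    [NormedAddCommGroup U₁] [NormedSpace ℝ U₁] [CompleteSpace U₁]
    [NormedAddCommGroup U₂] [NormedSpace ℝ U₂] [CompleteSpace U₂]
    [NormedAddCommGroup Xm] [NormedSpace ℝ Xm] [CompleteSpace Xm]
    (T : C0Semigroup X) (E : Extrapolation Xm T)
    (p q : ℝ) (hp : 1 ≤ p) (hq : 1 ≤ q)
    (B₁ : Xt →L[ℝ] Xm) (B₂ : U₂ →L[ℝ] Xm) (C₁ C₂ : ℝ → ℝ)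
    (hB₁ : IsLpAdmissibleFor (fun t => E.Tm t) E.ι p B₁ C₁)
    (hB₂ : IsLpAdmissibleFor (fun t => E.Tm t) E.ι q B₂ C₂)
    (m : ℝ) (hm : 0 < m) (F : X → U₁ → Xt) (hF : StandingAssumptions m F)
    (t₀ : ℝ) (ht₀ : 0 ≤ t₀) (x₀ : X) (u₁ : ℝ → U₁) (u₂ : ℝ → U₂)
    (hu₁m : AEStronglyMeasurable u₁ (volume.restrict (Set.Ioi 0)))
    (hu₁p : IntegrableOn (fun s => ‖u₁ s‖ ^ p) (Set.Ioi 0))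
    (hu₂m : AEStronglyMeasurable u₂ (volume.restrict (Set.Ioi 0)))
    (hu₂q : IntegrableOn (fun s => ‖u₂ s‖ ^ q) (Set.Ioi 0))
    -- `S` is the set of all `t₁ > t₀` such that the system has a unique mild solution
    -- on `[t₀, t₁]`:
    (S : Set ℝ)
    (hS : S = {t₁ : ℝ | t₀ < t₁ ∧ ∃ y : ℝ → X,
      IsMildSolutionOn T E B₁ B₂ F x₀ u₁ u₂ t₀ t₁ y ∧
      ∀ z : ℝ → X, IsMildSolutionOn T E B₁ B₂ F x₀ u₁ u₂ t₀ t₁ z →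
        Set.EqOn z y (Set.Icc t₀ t₁)})
    (hSne : S.Nonempty)
    -- `tmax < ∞`:
    (hSbdd : BddAbove S)
    (tmax : ℝ) (htmax : tmax = sSup S)
    -- `x` restricts to the mild solution on each interval `[t₀, t₁]`, `t₁ ∈ S`:
    (x : ℝ → X) (hx : ∀ t₁ ∈ S, IsMildSolutionOn T E B₁ B₂ F x₀ u₁ u₂ t₀ t₁ x) :
    Filter.Tendsto (fun t => ‖x t‖) (nhdsWithin tmax (Set.Iio tmax)) Filter.atTop := by
  have hP0 {r : ℝ} (hr : 1 ≤ r) : ENNReal.ofReal r ≠ 0 := by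
    simpa using zero_lt_one.trans_le hr
  have hmem₁ : MemLp u₁ (ENNReal.ofReal p) (volume.restrict (Ioi 0)) := by
    rw [← integrable_norm_rpow_iff hu₁m (hP0 hp) ENNReal.ofReal_ne_top,
      ENNReal.toReal_ofReal (zero_le_one.trans hp)]
    exact hu₁p
  have hmem₂ : MemLp u₂ (ENNReal.ofReal q) (volume.restrict (Ioi 0)) := by
    rw [← integrable_norm_rpow_iff hu₂m (hP0 hq) ENNReal.ofReal_ne_top,
      ENNReal.toReal_ofReal (zero_le_one.trans hq)]
    exact hu₂q
  have hlt : t₀ < tmax := by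
    obtain ⟨t₁, ht₁⟩ := hSne
    have h1 := le_csSup hSbdd ht₁
    rw [hS] at ht₁
    exact ht₁.1.trans_le (htmax ▸ h1)
  rw [tendsto_atTop]
  intro R
  by_contra hcon
  obtain ⟨δ, hδ, hext⟩ := exists_forall_isMildSolutionOn_add (x₀ := x₀) hB₁ hB₂ hp hq hm hF
    hmem₁ hmem₂ ht₀ (abs_nonneg R)
  have hev : ∀ᶠ t in nhdsWithin tmax (Iio tmax), t ∈ Ioo (max t₀ (tmax - δ)) tmax :=
    Ioo_mem_nhdsLT (max_lt hlt (by linarith))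
  obtain ⟨a, hxa, ha⟩ := ((not_eventually.1 hcon).and_eventually hev).exists
  have hta : t₀ < a := (le_max_left _ _).trans_lt ha.1
  have haδ : tmax < a + δ := by linarith [(le_max_right t₀ (tmax - δ)).trans_lt ha.1]
  obtain ⟨t₁, ht₁, hat₁⟩ := exists_lt_of_lt_csSup hSne (htmax ▸ ha.2)
  obtain ⟨y, hy⟩ := hext a hta.le x ((hx t₁ ht₁).mono hat₁.le)
    ((not_le.1 hxa).le.trans (le_abs_self R))
  have hmemS : a + δ ∈ S := by
    rw [hS]
    exact ⟨by linarith, y, hy, fun z hz =>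
      hz.eqOn hB₁ hB₂ hp hq hm hF hmem₁ hmem₂ ht₀ hy⟩
  have := le_csSup hSbdd hmemS
  rw [← htmax] at this
  linarith
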